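/- arXiv:2506.10804 — 2 statements merged into one kernel-verified Lean document; each statement's English description precedes it below -/
import Mathlib

section
/- Let I = (t₀, t_f) be a bounded open interval, x₀ ∈ ℝ^{n_x}, u ∈ L^∞(I)^{n_u}, p ∈ ℝ^{n_p}, and set y = (x, u(t), p) ∈ ℝ^{n_y}. Let f : I × ℝ^{n_y} × ℝ^{n_g} → ℝ^{n_x} be measurable in t ∈ I for each (y, g) ∈ ℝ^{n_y} × ℝ^{n_g}, continuous in (y, g) for almost all t ∈ I, and suppose there exists an integrable function m_f : I → ℝ such that ‖f(t, y, g)‖ ≤ m_f(t)(1 + ‖g‖) for almost all t ∈ I and all y ∈ ℝ^{n_y}, g ∈ ℝ^{n_g}. Then for any g ∈ (G¹(I))^{n_g} the initial value problem x'(t) = f(t, x(t), u(t), p, g(t, x(t), u(t), p)) for a.a. t ∈ I, x(t₀) = x₀ has a solution x ∈ W^{1,1}(I)^{n_x}. -/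
open MeasureTheory Set

/-- Membership of a component function `g : I × ℝ^{n_y} → ℝ^{n_g}` (with
`y = (x,u,p) ∈ ℝ^{n_x} × ℝ^{n_u} × ℝ^{n_p}`) in the space `(G¹(I))^{n_g}`:
`g` is measurable in `t` for each `y`, continuously differentiable in `y` for a.a. `t ∈ I`,
and the `G¹`-norm (ess-sup over `t` of the sup over `y` of `g` and of its `y`-Jacobian)
is finite; the constant `C` is a bound witnessing finiteness of the `G¹`-norm, so that
`‖g(t,y)‖ ≤ C` and `y ↦ g(t,y)` is `C`-Lipschitz for a.a. `t`. -/
def MemG1 {nx nu np ng : ℕ} (t0 tf : ℝ)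
    (g : ℝ → ((Fin nx → ℝ) × (Fin nu → ℝ) × (Fin np → ℝ)) → (Fin ng → ℝ)) : Prop :=
  (∀ y, Measurable fun t => g t y) ∧
  ∃ C : ℝ, ∀ᵐ t ∂(volume.restrict (Set.Ioo t0 tf)),
    ContDiff ℝ 1 (g t) ∧ (∀ y, ‖g t y‖ ≤ C) ∧
    (∀ y, ‖fderiv ℝ (g t) y‖ ≤ C)

/-- Superposition integrability. -/
lemma carath_integrable {E : Type*} [NormedAddCommGroup E] [NormedSpace ℝ E]
    [SecondCountableTopology E] [MeasurableSpace E] [BorelSpace E]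
    (F : ℝ → E → E) (m : ℝ → ℝ)
    (hF : Measurable (Function.uncurry F)) (hb : ∀ t x, ‖F t x‖ ≤ m t) (hm : Integrable m)
    (y : ℝ → E) (hy : Continuous y) : Integrable (fun s => F s (y s)) := by
  refine hm.mono' ?_ (Filter.Eventually.of_forall fun s => hb s _)
  exact (hF.comp (measurable_id.prodMk hy.measurable)).aestronglyMeasurable

/-- Tonelli's delayed approximation. -/
lemma carath_delay {E : Type*} [NormedAddCommGroup E] [NormedSpace ℝ E] [CompleteSpace E]
    [SecondCountableTopology E] [MeasurableSpace E] [BorelSpace E]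
    (F : ℝ → E → E) (m : ℝ → ℝ) (a b h : ℝ) (hh : 0 < h) (x0 : E)
    (hF : Measurable (Function.uncurry F)) (hb : ∀ t x, ‖F t x‖ ≤ m t) (hm : Integrable m) :
    ∃ z : ℝ → E, Continuous z ∧ ∀ t ≤ b, z t = x0 + ∫ s in a..(max a (t - h)), F s (z s) := by
  let y : ℕ → ℝ → E := fun j => Nat.rec (fun _ => x0)
    (fun _ w t => x0 + ∫ s in a..(max a (t - h)), F s (w s)) j
  have y0 : y 0 = fun _ => x0 := rfl
  have ys : ∀ j, y (j+1) = fun t => x0 + ∫ s in a..(max a (t - h)), F s (y j s) := fun j => rfl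
  have hc : ∀ j, Continuous (y j) := by
    intro j
    induction j with
    | zero => rw [y0]; exact continuous_const
    | succ j ih =>
      rw [ys]
      have hi := carath_integrable F m hF hb hm _ ih
      have := intervalIntegral.continuous_primitive
        (f := fun s => F s (y j s)) (μ := volume) (fun p q => hi.intervalIntegrable) a
      exact continuous_const.add (this.comp (by fun_prop))
  have hst : ∀ j : ℕ, ∀ t ≤ a + j * h, y (j+1) t = y j t := by
    intro j
    induction j with
    | zero =>
      intro t hta
      rw [ys, y0]
      have : max a (t - h) = a := max_eq_left (by simp at hta; linarith)
      simp [this]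
    | succ j ih =>
      intro t hta
      rw [ys (j+1), ys j]
      simp only
      congr 1
      apply intervalIntegral.integral_congr
      intro s hs
      simp only
      rw [uIcc_of_le (le_max_left _ _)] at hs
      refine congrArg (F s) (ih s ?_)
      push_cast at hta
      have h1 : 0 ≤ (j:ℝ) * h := by positivity
      refine hs.2.trans (max_le ?_ ?_) <;> nlinarith
  obtain ⟨j, hj⟩ := exists_nat_gt ((b - a) / h)
  refine ⟨y j, hc j, fun t htb => ?_⟩
  rw [div_lt_iff₀ hh] at hj
  rw [← hst j t (by linarith), ys]

/-- Carathéodory existence. -/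
lemma carath_exists {E : Type*} [NormedAddCommGroup E] [NormedSpace ℝ E] [ProperSpace E]
    [SecondCountableTopology E] [MeasurableSpace E] [BorelSpace E]
    (F : ℝ → E → E) (m : ℝ → ℝ) (a b : ℝ) (hab : a ≤ b) (x0 : E)
    (hF : Measurable (Function.uncurry F)) (hFc : ∀ t, Continuous (F t))
    (hb : ∀ t x, ‖F t x‖ ≤ m t) (hm : Integrable m) :
    ∃ x : ℝ → E, Continuous x ∧ ∀ t ∈ Icc a b, x t = x0 + ∫ s in a..t, F s (x s) := by
  have : CompleteSpace E := inferInstance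
  have hh : ∀ k : ℕ, 0 < 1 / ((k:ℝ) + 1) := fun k => by positivity
  choose z hzc hz using fun k : ℕ => carath_delay F m a b _ (hh k) x0 hF hb hm
  have hint : ∀ k, Integrable (fun s => F s (z k s)) :=
    fun k => carath_integrable F m hF hb hm _ (hzc k)
  let M : ℝ → ℝ := fun t => ∫ s in a..t, m s
  have hMc : Continuous M :=
    intervalIntegral.continuous_primitive (fun p q => hm.intervalIntegrable) a
  -- difference bound
  have hdiff : ∀ k s t, ‖(∫ r in a..t, F r (z k r)) - ∫ r in a..s, F r (z k r)‖ ≤ |M t - M s| := by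
    intro k s t
    simp only [M]
    rw [intervalIntegral.integral_interval_sub_left (hint k).intervalIntegrable
      (hint k).intervalIntegrable, intervalIntegral.integral_interval_sub_left
      hm.intervalIntegrable hm.intervalIntegrable]
    exact intervalIntegral.norm_integral_le_abs_of_norm_le
      (Filter.Eventually.of_forall fun r => hb r _) hm.intervalIntegrable
  let A : ℕ → BoundedContinuousFunction (Icc a b) E := fun k =>
    BoundedContinuousFunction.mkOfCompact ⟨fun t => z k t, (hzc k).comp continuous_subtype_val⟩
  have hA : ∀ k t, A k t = z k t := fun k t => rfl
  have huc : UniformContinuousOn M (Icc a b) :=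
    isCompact_Icc.uniformContinuousOn_of_continuous hMc.continuousOn
  have hmem : ∀ (k : ℕ) (t : Icc a b), max a ((t:ℝ) - 1 / ((k:ℝ) + 1)) ∈ Icc a b := by
    intro k t
    refine ⟨le_max_left _ _, max_le hab ?_⟩
    have := hh k
    have := t.2.2
    linarith
  obtain ⟨R, hR⟩ : ∃ R, ∀ t ∈ Icc a b, ‖M t‖ ≤ R :=
    isCompact_Icc.exists_bound_of_continuousOn hMc.continuousOn
  have hcomp : IsCompact (closure (Set.range A)) := by
    apply BoundedContinuousFunction.arzela_ascoli (Metric.closedBall x0 R)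
      (isCompact_closedBall _ _)
    · rintro _ t ⟨k, rfl⟩
      rw [hA, hz k t t.2.2, mem_closedBall_iff_norm, add_sub_cancel_left]
      have h1 := hdiff k a (max a ((t:ℝ) - 1 / ((k:ℝ) + 1)))
      have h2 := hR _ (hmem k t)
      simp only [M, intervalIntegral.integral_same, sub_zero] at h1 h2
      exact h1.trans h2
    · intro t
      rw [Metric.equicontinuousAt_iff_right]
      intro ε hε
      obtain ⟨δ, hδ, H⟩ := Metric.uniformContinuousOn_iff.1 huc ε hε
      filter_upwards [Metric.ball_mem_nhds t hδ] with s hs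
      rintro ⟨_, k, rfl⟩
      simp only [hA]
      rw [hz k t t.2.2, hz k s s.2.2, dist_add_left, dist_eq_norm]
      refine (hdiff k _ _).trans_lt ?_
      rw [← Real.dist_eq]
      apply H _ (hmem k t) _ (hmem k s)
      rw [Metric.mem_ball'] at hs
      refine lt_of_le_of_lt ?_ hs
      rw [Subtype.dist_eq, Real.dist_eq, Real.dist_eq]
      have := abs_max_sub_max_le_abs ((t:ℝ) - 1 / ((k:ℝ) + 1)) ((s:ℝ) - 1 / ((k:ℝ) + 1)) a
      rw [max_comm a, max_comm a]
      simpa using this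
  obtain ⟨φ, -, σ, hσ, hlim⟩ := hcomp.tendsto_subseq (fun k => subset_closure (mem_range_self k))
  have hpt : ∀ t (ht : t ∈ Icc a b),
      Filter.Tendsto (fun k => z (σ k) t) Filter.atTop (nhds (φ ⟨t, ht⟩)) := by
    intro t ht
    have h1 := BoundedContinuousFunction.tendsto_iff_tendstoUniformly.1 hlim
    exact h1.tendsto_at ⟨t, ht⟩
  let x : ℝ → E := fun t => φ (projIcc a b hab t)
  have hx : ∀ t (ht : t ∈ Icc a b), x t = φ ⟨t, ht⟩ := fun t ht => by
    simp only [x, projIcc_of_mem hab ht]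
  have hxc : Continuous x := φ.continuous.comp continuous_projIcc
  refine ⟨x, hxc, fun t ht => ?_⟩
  have l1 : Filter.Tendsto (fun k => z (σ k) t) Filter.atTop (nhds (x t)) := by
    rw [hx t ht]; exact hpt t ht
  have l2 : Filter.Tendsto (fun k => ∫ s in a..t, F s (z (σ k) s)) Filter.atTop
      (nhds (∫ s in a..t, F s (x s))) := by
    apply intervalIntegral.tendsto_integral_filter_of_dominated_convergence m
    · exact Filter.Eventually.of_forall fun k => (hint _).aestronglyMeasurable.restrict
    · exact Filter.Eventually.of_forall fun k => Filter.Eventually.of_forall fun s _ => hb _ _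
    · exact hm.intervalIntegrable
    · refine Filter.Eventually.of_forall fun s hs => ?_
      rw [uIoc_of_le ht.1] at hs
      have hs' : s ∈ Icc a b := ⟨hs.1.le, hs.2.trans ht.2⟩
      rw [hx s hs']
      exact ((hFc s).tendsto _).comp (hpt s hs')
  have l3 : Filter.Tendsto (fun k => (∫ s in a..(max a (t - 1 / ((σ k : ℝ) + 1))),
      F s (z (σ k) s)) - ∫ s in a..t, F s (z (σ k) s)) Filter.atTop (nhds 0) := by
    apply squeeze_zero_norm (fun k => hdiff (σ k) _ _)
    have e1 : Filter.Tendsto (fun k => max a (t - 1 / ((σ k : ℝ) + 1))) Filter.atTop (nhds t) := by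
      have e0 := (tendsto_one_div_add_atTop_nhds_zero_nat (𝕜 := ℝ)).comp hσ.tendsto_atTop
      have := (tendsto_const_nhds (x := a)).max ((tendsto_const_nhds (x := t)).sub e0)
      simpa [max_eq_right ht.1] using this
    have := (((hMc.tendsto t).comp e1).sub_const (M t)).abs
    simpa using this
  have l4 : Filter.Tendsto (fun k => z (σ k) t) Filter.atTop
      (nhds (x0 + ∫ s in a..t, F s (x s))) := by
    have := (l3.add l2).const_add x0
    simp only [sub_add_cancel, zero_add] at this
    refine this.congr fun k => ?_
    rw [hz (σ k) t ht.2]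
  exact tendsto_nhds_unique l1 l4

/-- Theorem 2.6, first part.  With `u ∈ L^∞(I)^{n_u}`, `p ∈ ℝ^{n_p}`,
`f` Carathéodory with growth `‖f(t,y,g)‖ ≤ m_f(t)(1 + ‖g‖)` for integrable `m_f`, and any
`g ∈ (G¹(I))^{n_g}`, the IVP `x' = f(t, x, u(t), p, g(t, x, u(t), p))` a.e. on `I`,
`x(t₀) = x₀` has a solution `x ∈ W^{1,1}(I)^{n_x}`. -/
theorem ivp_with_model_existence
    {nx nu np ng : ℕ} (t0 tf : ℝ) (ht : t0 < tf) (x0 : Fin nx → ℝ)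
    (u : ℝ → (Fin nu → ℝ)) (p : Fin np → ℝ)
    (f : ℝ → ((Fin nx → ℝ) × (Fin nu → ℝ) × (Fin np → ℝ)) → (Fin ng → ℝ) → (Fin nx → ℝ))
    (g : ℝ → ((Fin nx → ℝ) × (Fin nu → ℝ) × (Fin np → ℝ)) → (Fin ng → ℝ))
    (m_f : ℝ → ℝ)
    (hu_meas : AEStronglyMeasurable u (volume.restrict (Set.Ioo t0 tf)))
    (hu_bdd : ∃ Cu : ℝ, ∀ᵐ t ∂(volume.restrict (Set.Ioo t0 tf)), ‖u t‖ ≤ Cu)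
    (hf_meas : ∀ y gv, Measurable fun t => f t y gv)
    (hf_cont : ∀ᵐ t ∂(volume.restrict (Set.Ioo t0 tf)),
      Continuous fun w : ((Fin nx → ℝ) × (Fin nu → ℝ) × (Fin np → ℝ)) × (Fin ng → ℝ) =>
        f t w.1 w.2)
    (hmf_int : IntegrableOn m_f (Set.Ioo t0 tf))
    (hf_growth : ∀ᵐ t ∂(volume.restrict (Set.Ioo t0 tf)), ∀ y gv,
      ‖f t y gv‖ ≤ m_f t * (1 + ‖gv‖))
    (hg : MemG1 t0 tf g) :
    ∃ x : ℝ → (Fin nx → ℝ),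
      ContinuousOn x (Set.Icc t0 tf) ∧
      IntegrableOn (fun s => f s (x s, u s, p) (g s (x s, u s, p))) (Set.Ioo t0 tf) ∧
      ∀ t ∈ Set.Icc t0 tf,
        x t = x0 + ∫ s in t0..t, f s (x s, u s, p) (g s (x s, u s, p)) := by
  classical
  obtain ⟨hg_meas, C, hgC⟩ := hg
  let μ := volume.restrict (Set.Ioo t0 tf)
  let u' := hu_meas.mk u
  have hu' : Measurable u' := hu_meas.stronglyMeasurable_mk.measurable
  have hae : ∀ᵐ t ∂μ, u t = u' t ∧ (Continuous fun w : ((Fin nx → ℝ) × (Fin nu → ℝ) ×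
      (Fin np → ℝ)) × (Fin ng → ℝ) => f t w.1 w.2) ∧
      (∀ y gv, ‖f t y gv‖ ≤ m_f t * (1 + ‖gv‖)) ∧ Continuous (g t) ∧ (∀ y, ‖g t y‖ ≤ C) := by
    filter_upwards [hu_meas.ae_eq_mk, hf_cont, hf_growth, hgC] with t h1 h2 h3 h4
    exact ⟨h1, h2, h3, h4.1.continuous, h4.2.1⟩
  obtain ⟨S, hSsub, hSm, hSae⟩ : ∃ S : Set ℝ, (∀ t ∈ S, t ∈ Ioo t0 tf ∧ u t = u' t ∧
      (Continuous fun w : ((Fin nx → ℝ) × (Fin nu → ℝ) ×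
      (Fin np → ℝ)) × (Fin ng → ℝ) => f t w.1 w.2) ∧
      (∀ y gv, ‖f t y gv‖ ≤ m_f t * (1 + ‖gv‖)) ∧ Continuous (g t) ∧ (∀ y, ‖g t y‖ ≤ C)) ∧
      MeasurableSet S ∧ ∀ᵐ t ∂μ, t ∈ S := by
    have hmem : ∀ᵐ t ∂μ, t ∈ Ioo t0 tf := ae_restrict_mem measurableSet_Ioo
    obtain ⟨S, hS, hm, h⟩ := (hmem.and hae).exists_measurable_mem
    exact ⟨S, fun t ht => h t ht, hm, hS⟩
  let f' : (((Fin nx → ℝ) × (Fin nu → ℝ) × (Fin np → ℝ)) × (Fin ng → ℝ)) → ℝ → (Fin nx → ℝ) :=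
    fun w t => if t ∈ S then f t w.1 w.2 else 0
  let g' : ((Fin nx → ℝ) × (Fin nu → ℝ) × (Fin np → ℝ)) → ℝ → (Fin ng → ℝ) :=
    fun y t => if t ∈ S then g t y else 0
  have hf'c : ∀ t, Continuous fun w => f' w t := by
    intro t
    by_cases h : t ∈ S
    · simpa [f', h] using (hSsub t h).2.2.1
    · simp only [f', h, if_false]; exact continuous_const
  have hg'c : ∀ t, Continuous fun y => g' y t := by
    intro t
    by_cases h : t ∈ S
    · simpa [g', h] using (hSsub t h).2.2.2.2.1
    · simp only [g', h, if_false]; exact continuous_const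
  have hf'm : Measurable (Function.uncurry f') :=
    measurable_uncurry_of_continuous_of_measurable hf'c
      (fun w => Measurable.ite hSm (hf_meas _ _) measurable_const)
  have hg'm : Measurable (Function.uncurry g') :=
    measurable_uncurry_of_continuous_of_measurable hg'c
      (fun w => Measurable.ite hSm (hg_meas _) measurable_const)
  let F : ℝ → (Fin nx → ℝ) → (Fin nx → ℝ) := fun t x =>
    f' ((x, u' t, p), g' (x, u' t, p) t) t
  have hFm : Measurable (Function.uncurry F) := by
    have hy : Measurable fun q : ℝ × (Fin nx → ℝ) => (q.2, u' q.1, p) :=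
      measurable_snd.prodMk ((hu'.comp measurable_fst).prodMk measurable_const)
    have hgy : Measurable fun q : ℝ × (Fin nx → ℝ) => g' (q.2, u' q.1, p) q.1 :=
      hg'm.comp (hy.prodMk measurable_fst)
    exact hf'm.comp ((hy.prodMk hgy).prodMk measurable_fst)
  have hFc : ∀ t, Continuous (F t) := by
    intro t
    have hy : Continuous fun x : (Fin nx → ℝ) => (x, u' t, p) := by fun_prop
    exact (hf'c t).comp (hy.prodMk ((hg'c t).comp hy))
  let m : ℝ → ℝ := S.indicator fun t => m_f t * (1 + C)
  have hSI : S ⊆ Ioo t0 tf := fun t h => (hSsub t h).1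
  have hm : Integrable m := by
    rw [integrable_indicator_iff hSm]
    exact (hmf_int.mono_set hSI).mul_const _
  have hb : ∀ t x, ‖F t x‖ ≤ m t := by
    intro t x
    by_cases h : t ∈ S
    · obtain ⟨-, -, -, h3, -, h5⟩ := hSsub t h
      simp only [F, f', g', m, h, if_true, Set.indicator_of_mem]
      refine (h3 _ _).trans ?_
      have h0 : 0 ≤ m_f t := by
        have := (norm_nonneg _).trans (h3 0 0)
        simpa using this
      have := h5 (x, u' t, p)
      gcongr
    · simp [F, f', m, h]
  obtain ⟨x, hxc, hx⟩ := carath_exists F m t0 tf ht.le x0 hFm hFc hb hm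
  have heq : ∀ᵐ s ∂μ, F s (x s) = f s (x s, u s, p) (g s (x s, u s, p)) := by
    filter_upwards [hSae] with s hs
    simp only [F, f', g', hs, if_true, (hSsub s hs).2.1]
  refine ⟨x, hxc.continuousOn, ?_, fun t htt => ?_⟩
  · exact ((carath_integrable F m hFm hb hm x hxc).integrableOn (s := Ioo t0 tf)).congr heq
  · rw [hx t htt]
    congr 1
    apply intervalIntegral.integral_congr_ae_restrict
    rw [uIoc_of_le htt.1]
    have heq' : ∀ᵐ s ∂(volume.restrict (Ioc t0 tf)),
        F s (x s) = f s (x s, u s, p) (g s (x s, u s, p)) := by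
      rw [← Measure.restrict_congr_set Ioo_ae_eq_Ioc]
      exact heq
    exact ae_restrict_of_ae_restrict_of_subset (Ioc_subset_Ioc_right htt.2) heq'
end

section
/- Let I = (t₀, t_f) be a bounded open interval and let φ : I × ℝ^{n_y} × ℝ^{n_g} → ℝ^{n_φ} be measurable in t ∈ I for all (y, g), continuously partially differentiable with respect to (y, g) ∈ ℝ^{n_y} × ℝ^{n_g} for almost all t ∈ I, and satisfy: (i) there exists K with ‖φ_y(t, 0, 0)‖ ≤ K and ‖φ_g(t, 0, 0)‖ ≤ K for a.a. t ∈ I; (ii) for all R > 0 there exists L(R) such that ‖φ_y(t, y₁, g₁) − φ_y(t, y₂, g₂)‖ + ‖φ_g(t, y₁, g₁) − φ_g(t, y₂, g₂)‖ ≤ L(R)(‖y₁ − y₂‖ + ‖g₁ − g₂‖) for a.a. t ∈ I and all y₁, y₂, g₁, g₂ in the closed ball of radius R. Then the Nemytskii operator Φ : L^∞(I)^{n_y} × (G²(I))^{n_g} → L^∞(I)^{n_φ}, Φ(y, g) := φ(·, y(·), g(·, y(·))), is continuously Fréchet differentiable, with derivative [Φ'(y, g)(δy, δg)](t) = [φ_y(t,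 y(t), g(t, y(t))) + φ_g(t, y(t), g(t, y(t))) g_y(t, y(t))] δy(t) + φ_g(t, y(t), g(t, y(t))) δg(t, y(t)). -/
open MeasureTheory Set
open scoped NNReal ENNReal

noncomputable section

/-- The restriction of Lebesgue measure to the interval `I = (t₀, t_f)`. -/
def μI (t0 tf : ℝ) : Measure ℝ := volume.restrict (Set.Ioo t0 tf)

/-- `L^∞(I)^n` (extended) norm: essential supremum of `‖x(t)‖` over `I`. -/
def eLinf {n : ℕ} (t0 tf : ℝ) (x : ℝ → (Fin n → ℝ)) : ℝ≥0∞ :=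
  essSup (fun t => (‖x t‖₊ : ℝ≥0∞)) (μI t0 tf)

/-- Membership in `L^∞(I)^n`: a.e.-measurable and essentially bounded. -/
def MemLinf {n : ℕ} (t0 tf : ℝ) (x : ℝ → (Fin n → ℝ)) : Prop :=
  AEStronglyMeasurable x (μI t0 tf) ∧ eLinf t0 tf x < ⊤

/-- The (extended) `G^s(I)`-norm of a component function `g : I × ℝ^{n_y} → ℝ^m`:
`Σ_{k=0}^{s} ess sup_{t∈I} sup_{y} ‖∂^k g(t,y)/∂y^k‖`. -/
def gNormE {ny m : ℕ} (t0 tf : ℝ) (s : ℕ)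
    (g : ℝ → (Fin ny → ℝ) → (Fin m → ℝ)) : ℝ≥0∞ :=
  ∑ k ∈ Finset.range (s + 1),
    essSup (fun t => ⨆ y : Fin ny → ℝ, (‖iteratedFDeriv ℝ k (g t) y‖₊ : ℝ≥0∞)) (μI t0 tf)

/-- Membership in the Banach space `(G^s(I))^m`: measurable in `t` for each `y`, `s`-times
continuously differentiable in `y` for a.a. `t ∈ I`, with finite `G^s`-norm. -/
def MemG {ny m : ℕ} (t0 tf : ℝ) (s : ℕ) (g : ℝ → (Fin ny → ℝ) → (Fin m → ℝ)) : Prop :=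
  (∀ y, Measurable fun t => g t y) ∧
  (∀ᵐ t ∂(μI t0 tf), ContDiff ℝ (s : ℕ∞) (g t)) ∧
  gNormE t0 tf s g < ⊤

/-- The Nemytskii operator `Φ(y, g) := φ(·, y(·), g(·, y(·)))`. -/
def nemOp {ny ng nphi : ℕ}
    (φ : ℝ → (Fin ny → ℝ) → (Fin ng → ℝ) → (Fin nphi → ℝ))
    (y : ℝ → (Fin ny → ℝ)) (g : ℝ → (Fin ny → ℝ) → (Fin ng → ℝ)) : ℝ → (Fin nphi → ℝ) :=
  fun t => φ t (y t) (g t (y t))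

/-- The claimed Fréchet derivative of the Nemytskii operator at `(y, g)` in direction
`(δy, δg)`:
`[Φ'(y,g)(δy,δg)](t) = [φ_y + φ_g g_y]δy(t) + φ_g δg(t, y(t))`. -/
def nemDeriv {ny ng nphi : ℕ}
    (φ : ℝ → (Fin ny → ℝ) → (Fin ng → ℝ) → (Fin nphi → ℝ))
    (y : ℝ → (Fin ny → ℝ)) (g : ℝ → (Fin ny → ℝ) → (Fin ng → ℝ))
    (δy : ℝ → (Fin ny → ℝ)) (δg : ℝ → (Fin ny → ℝ) → (Fin ng → ℝ)) : ℝ → (Fin nphi → ℝ) :=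
  fun t =>
    (fderiv ℝ (fun y' => φ t y' (g t (y t))) (y t)) (δy t)
      + (fderiv ℝ (fun g' => φ t (y t) g') (g t (y t)))
          ((fderiv ℝ (g t) (y t)) (δy t) + δg t (y t))

/-- Pointwise bounds up to second order. -/
def GB {ny m : ℕ} (B : ℝ) (f : (Fin ny → ℝ) → (Fin m → ℝ)) : Prop :=
  Differentiable ℝ f ∧ (∀ y, ‖f y‖ ≤ B) ∧ (∀ y, ‖fderiv ℝ f y‖ ≤ B) ∧
    ∀ y z, ‖fderiv ℝ f y - fderiv ℝ f z‖ ≤ B * ‖y - z‖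

lemma ae_of_eLinf {n : ℕ} {t0 tf : ℝ} {x : ℝ → (Fin n → ℝ)} {B : ℝ} (hB : 0 ≤ B)
    (h : eLinf t0 tf x ≤ ENNReal.ofReal B) : ∀ᵐ t ∂(μI t0 tf), ‖x t‖ ≤ B := by
  filter_upwards [ENNReal.ae_le_essSup (μ := μI t0 tf) (fun t => (‖x t‖₊ : ℝ≥0∞))] with t h1
  have h2 := h1.trans h
  rw [← ENNReal.ofReal_coe_nnreal, ENNReal.ofReal_le_ofReal_iff hB] at h2
  exact h2

lemma eLinf_le {n : ℕ} {t0 tf : ℝ} {x : ℝ → (Fin n → ℝ)} {B : ℝ}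
    (h : ∀ᵐ t ∂(μI t0 tf), ‖x t‖ ≤ B) : eLinf t0 tf x ≤ ENNReal.ofReal B := by
  refine essSup_le_of_ae_le _ ?_
  filter_upwards [h] with t h1
  rw [← ENNReal.ofReal_coe_nnreal]
  exact ENNReal.ofReal_le_ofReal h1

lemma ae_GB {ny m : ℕ} {t0 tf : ℝ} {g : ℝ → (Fin ny → ℝ) → (Fin m → ℝ)} {B : ℝ} (hB : 0 ≤ B)
    (hd : ∀ᵐ t ∂(μI t0 tf), ContDiff ℝ ((2 : ℕ) : ℕ∞) (g t))
    (h : gNormE t0 tf 2 g ≤ ENNReal.ofReal B) : ∀ᵐ t ∂(μI t0 tf), GB B (g t) := by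
  have key : ∀ k ∈ Finset.range (2 + 1), ∀ᵐ t ∂(μI t0 tf), ∀ y,
      ‖iteratedFDeriv ℝ k (g t) y‖ ≤ B := by
    intro k hk
    filter_upwards [ENNReal.ae_le_essSup (μ := μI t0 tf)
      (fun t => ⨆ y : Fin ny → ℝ, (‖iteratedFDeriv ℝ k (g t) y‖₊ : ℝ≥0∞))] with t h1 y
    have h2 : (‖iteratedFDeriv ℝ k (g t) y‖₊ : ℝ≥0∞) ≤ ENNReal.ofReal B := by
      refine (le_iSup (fun y : Fin ny → ℝ => (‖iteratedFDeriv ℝ k (g t) y‖₊ : ℝ≥0∞)) y).trans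
        (h1.trans (le_trans ?_ h))
      unfold gNormE
      exact Finset.single_le_sum (f := fun k => essSup (fun t => ⨆ y : Fin ny → ℝ,
        (‖iteratedFDeriv ℝ k (g t) y‖₊ : ℝ≥0∞)) (μI t0 tf)) (fun _ _ => zero_le) hk
    rw [← ENNReal.ofReal_coe_nnreal, ENNReal.ofReal_le_ofReal_iff hB] at h2
    exact h2
  filter_upwards [hd, key 0 (by simp), key 1 (by simp), key 2 (by simp)] with t hd h0 h1 h2
  have hd' : ContDiff ℝ 2 (g t) := hd
  have hdd : Differentiable ℝ (fderiv ℝ (g t)) :=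
    (hd'.fderiv_right (m := 1) (by norm_num)).differentiable (by norm_num)
  refine ⟨hd'.differentiable (by norm_num), fun y => ?_, fun y => ?_, fun y z => ?_⟩
  · simpa using h0 y
  · simpa using h1 y
  · refine Convex.norm_image_sub_le_of_norm_fderiv_le (𝕜 := ℝ) (s := univ)
      (fun x _ => hdd x) (fun x _ => ?_) convex_univ (mem_univ _) (mem_univ _)
    have := h2 x
    rw [← norm_iteratedFDeriv_fderiv] at this
    simpa using this

section det
variable {E G H : Type*} [NormedAddCommGroup E] [NormedSpace ℝ E] [NormedAddCommGroup G]
  [NormedSpace ℝ G] [NormedAddCommGroup H] [NormedSpace ℝ H]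

lemma fderiv_pair {F : E → G → H} (hF : Differentiable ℝ (fun w : E × G => F w.1 w.2)) (w : E × G) :
    HasFDerivAt (fun w : E × G => F w.1 w.2)
      ((fderiv ℝ (fun y => F y w.2) w.1).coprod (fderiv ℝ (fun z => F w.1 z) w.2)) w := by
  have h := (hF w).hasFDerivAt
  have h1 : HasFDerivAt (fun y => F y w.2) _ w.1 :=
    HasFDerivAt.comp (f := fun e : E => (e, w.2)) (g := fun w : E × G => F w.1 w.2) w.1 h
      (hasFDerivAt_prodMk_left (𝕜 := ℝ) w.1 w.2)
  have h2 : HasFDerivAt (fun z => F w.1 z) _ w.2 :=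
    HasFDerivAt.comp (f := fun e : G => (w.1, e)) (g := fun w : E × G => F w.1 w.2) w.2 h
      (hasFDerivAt_prodMk_right (𝕜 := ℝ) w.1 w.2)
  rw [h1.fderiv, h2.fderiv]
  convert h using 1
  ext x <;> simp

lemma taylor_pair {F : E → G → H} (hF : Differentiable ℝ (fun w : E × G => F w.1 w.2))
    {L p q : ℝ} {y0 y1 : E} {z0 z1 : G} (hL : 0 ≤ L)
    (hy : ‖y1 - y0‖ ≤ p) (hz : ‖z1 - z0‖ ≤ q)
    (hlip : ∀ y z, ‖y - y0‖ ≤ p → ‖z - z0‖ ≤ q →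
      ‖fderiv ℝ (fun y' => F y' z) y - fderiv ℝ (fun y' => F y' z0) y0‖
        + ‖fderiv ℝ (fun z' => F y z') z - fderiv ℝ (fun z' => F y0 z') z0‖
        ≤ L * (‖y - y0‖ + ‖z - z0‖)) :
    ‖F y1 z1 - F y0 z0 - (fderiv ℝ (fun y' => F y' z0) y0 (y1 - y0)
      + fderiv ℝ (fun z' => F y0 z') z0 (z1 - z0))‖ ≤ L * (p + q) * (p + q) := by
  have hp : 0 ≤ p := (norm_nonneg _).trans hy
  have hq : 0 ≤ q := (norm_nonneg _).trans hz
  have := Convex.norm_image_sub_le_of_norm_hasFDerivWithin_le' (𝕜 := ℝ)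
    (f := fun w : E × G => F w.1 w.2) (C := L * (p + q))
    (s := Metric.closedBall y0 p ×ˢ Metric.closedBall z0 q) (x := (y0, z0)) (y := (y1, z1))
    (φ := (fderiv ℝ (fun y' => F y' z0) y0).coprod (fderiv ℝ (fun z' => F y0 z') z0))
    (fun w _ => (fderiv_pair hF w).hasFDerivWithinAt) ?_
    ((convex_closedBall _ _).prod (convex_closedBall _ _))
    (by simp [hp, hq]) (by simp [dist_eq_norm, hy, hz])
  · refine le_trans (le_of_eq (by simp)) (this.trans ?_)
    refine mul_le_mul_of_nonneg_left ?_ (by positivity)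
    simp only [Prod.mk_sub_mk, Prod.norm_mk]
    exact max_le (by linarith) (by linarith)
  · rintro ⟨y, z⟩ ⟨h1, h2⟩
    simp only [Metric.mem_closedBall, dist_eq_norm] at h1 h2
    have h3 := hlip y z h1 h2
    have h4 : L * (‖y - y0‖ + ‖z - z0‖) ≤ L * (p + q) := by gcongr
    refine ContinuousLinearMap.opNorm_le_bound _ (by positivity) ?_
    rintro ⟨u, v⟩
    have e1 := ((fderiv ℝ (fun y' => F y' z) y - fderiv ℝ (fun y' => F y' z0) y0)).le_opNorm u
    have e2 := ((fderiv ℝ (fun z' => F y z') z - fderiv ℝ (fun z' => F y0 z') z0)).le_opNorm v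
    have e3 : ‖u‖ ≤ ‖(u, v)‖ := norm_fst_le (u, v)
    have e4 : ‖v‖ ≤ ‖(u, v)‖ := norm_snd_le (u, v)
    calc _ = ‖(fderiv ℝ (fun y' => F y' z) y - fderiv ℝ (fun y' => F y' z0) y0) u
          + (fderiv ℝ (fun z' => F y z') z - fderiv ℝ (fun z' => F y0 z') z0) v‖ := by
          congr 1; simp; abel
      _ ≤ _ := norm_add_le _ _
      _ ≤ ‖fderiv ℝ (fun y' => F y' z) y - fderiv ℝ (fun y' => F y' z0) y0‖ * ‖(u, v)‖
        + ‖fderiv ℝ (fun z' => F y z') z - fderiv ℝ (fun z' => F y0 z') z0‖ * ‖(u, v)‖ := by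
          refine add_le_add (e1.trans ?_) (e2.trans ?_) <;> gcongr
      _ ≤ L * (p + q) * ‖(u, v)‖ := by
          rw [← add_mul]; gcongr; linarith

end det

lemma GB.lip {ny m : ℕ} {B : ℝ} {f : (Fin ny → ℝ) → (Fin m → ℝ)} (h : GB B f) (y z) :
    ‖f y - f z‖ ≤ B * ‖y - z‖ :=
  Convex.norm_image_sub_le_of_norm_fderiv_le (𝕜 := ℝ) (s := univ)
      (fun x _ => h.1 x) (fun x _ => h.2.2.1 x) convex_univ (mem_univ _) (mem_univ _)

lemma GB.nonneg {ny m : ℕ} {B : ℝ} {f : (Fin ny → ℝ) → (Fin m → ℝ)} (h : GB B f) : 0 ≤ B :=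
  (norm_nonneg _).trans (h.2.1 0)

lemma GB.taylor {ny m : ℕ} {B r : ℝ} {f : (Fin ny → ℝ) → (Fin m → ℝ)} (h : GB B f) {y z}
    (hr : ‖y - z‖ ≤ r) :
    ‖f y - f z - fderiv ℝ f z (y - z)‖ ≤ B * r * r := by
  have hr0 : 0 ≤ r := (norm_nonneg _).trans hr
  have hB := h.nonneg
  have := Convex.norm_image_sub_le_of_norm_fderiv_le' (𝕜 := ℝ) (s := Metric.closedBall z r)
      (C := B * r) (φ := fderiv ℝ f z) (x := z) (y := y)
      (fun x _ => h.1 x) (fun x hx => (h.2.2.2 x z).trans ?_) (convex_closedBall _ _)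
      (by simp [hr0]) (by simpa [dist_eq_norm] using hr)
  · refine this.trans ?_
    gcongr
  · rw [Metric.mem_closedBall, dist_eq_norm] at hx
    gcongr

section det2
variable {ny ng nphi : ℕ} {F : (Fin ny → ℝ) → (Fin ng → ℝ) → (Fin nphi → ℝ)}

/-- Lipschitz condition on the partial derivatives in the ball of radius `R`. -/
def PLip (F : (Fin ny → ℝ) → (Fin ng → ℝ) → (Fin nphi → ℝ)) (R L : ℝ) : Prop :=
  ∀ y₁ y₂ : Fin ny → ℝ, ∀ g₁ g₂ : Fin ng → ℝ,
        ‖y₁‖ ≤ R → ‖y₂‖ ≤ R → ‖g₁‖ ≤ R → ‖g₂‖ ≤ R →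
        ‖fderiv ℝ (fun y' => F y' g₁) y₁ - fderiv ℝ (fun y' => F y' g₂) y₂‖
          + ‖fderiv ℝ (fun g' => F y₁ g') g₁ - fderiv ℝ (fun g' => F y₂ g') g₂‖
          ≤ L * (‖y₁ - y₂‖ + ‖g₁ - g₂‖)

lemma bound_Fg {R L K : ℝ} (hL : 0 ≤ L) (hlip : PLip F R L)
    (hK : ‖fderiv ℝ (fun g' => F 0 g') 0‖ ≤ K) {y z} (hy : ‖y‖ ≤ R) (hz : ‖z‖ ≤ R) :
    ‖fderiv ℝ (fun g' => F y g') z‖ ≤ K + L * (2 * R) := by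
  have hR : 0 ≤ R := (norm_nonneg _).trans hy
  have h := hlip y 0 z 0 hy (by simpa) hz (by simpa)
  have h0 := norm_nonneg (fderiv ℝ (fun y' => F y' z) y - fderiv ℝ (fun y' => F y' 0) 0)
  have h1 := norm_le_norm_add_norm_sub' (fderiv ℝ (fun g' => F y g') z)
    (fderiv ℝ (fun g' => F 0 g') 0)
  rw [sub_zero, sub_zero] at h
  have h2 : L * (‖y‖ + ‖z‖) ≤ L * (2 * R) := by gcongr; linarith
  linarith

lemma det_one (hF : Differentiable ℝ (fun w : (Fin ny → ℝ) × (Fin ng → ℝ) => F w.1 w.2))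
    {a b R L K h : ℝ} (hL : 0 ≤ L) (hR : a + 2 * b + 2 ≤ R) (hlip : PLip F R L)
    (hK : ‖fderiv ℝ (fun g' => F 0 g') 0‖ ≤ K)
    {y dy : Fin ny → ℝ} {g dg : (Fin ny → ℝ) → (Fin ng → ℝ)}
    (hy : ‖y‖ ≤ a) (hg : GB b g) (hdy : ‖dy‖ ≤ h) (hdg : GB h dg) (h1 : h ≤ 1) :
    ‖F (y + dy) (g (y + dy) + dg (y + dy)) - F y (g y)
      - (fderiv ℝ (fun y' => F y' (g y)) y dy
        + fderiv ℝ (fun g' => F y g') (g y) (fderiv ℝ g y dy + dg y))‖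
    ≤ (L * (b + 2) * (b + 2) + (K + L * (2 * R)) * (b + 1)) * h * h := by
  have hb := hg.nonneg
  have hh := hdg.nonneg
  have ha : 0 ≤ a := (norm_nonneg _).trans hy
  have hgy := hg.2.1 y
  set z0 := g y with hz0
  set z1 := g (y + dy) + dg (y + dy) with hz1
  have hbh : b * h ≤ b := by nlinarith
  have hq : ‖z1 - z0‖ ≤ (b + 1) * h := by
    have e1 := hg.lip (y + dy) y
    have e2 := hdg.2.1 (y + dy)
    rw [add_sub_cancel_left] at e1
    have e3 : b * ‖dy‖ ≤ b * h := by gcongr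
    have e4 : z1 - z0 = (g (y + dy) - g y) + dg (y + dy) := by rw [hz1, hz0]; abel
    rw [e4]
    refine (norm_add_le _ _).trans ?_
    linarith
  have T := taylor_pair hF (L := L) (p := h) (q := (b + 1) * h) (y0 := y) (y1 := y + dy) (z0 := z0)
    (z1 := z1) hL (by simpa) hq (fun y' z' h1' h2' => by
      have e1 := norm_le_norm_add_norm_sub' y' y
      have e2 := norm_le_norm_add_norm_sub' z' z0
      apply hlip <;> linarith)
  have hM := bound_Fg hL hlip hK (y := y) (z := z0) (by linarith) (by linarith)
  have hr : ‖z1 - z0 - (fderiv ℝ g y dy + dg y)‖ ≤ (b + 1) * h * h := by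
    have e1 := hg.taylor (y := y + dy) (z := y) (r := h) (by simpa)
    have e2 := hdg.lip (y + dy) y
    rw [add_sub_cancel_left] at e1 e2
    have e3 : h * ‖dy‖ ≤ h * h := by gcongr
    have e4 : z1 - z0 - (fderiv ℝ g y dy + dg y)
      = (g (y + dy) - g y - fderiv ℝ g y dy) + (dg (y + dy) - dg y) := by rw [hz1, hz0]; abel
    rw [e4]
    refine (norm_add_le _ _).trans ?_
    linarith
  rw [add_sub_cancel_left] at T
  have hr2 : ‖fderiv ℝ (fun g' => F y g') z0 (z1 - z0 - (fderiv ℝ g y dy + dg y))‖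
      ≤ (K + L * (2 * R)) * ((b + 1) * h * h) := by
    refine (ContinuousLinearMap.le_opNorm _ _).trans ?_
    exact mul_le_mul hM hr (norm_nonneg _) ((norm_nonneg _).trans hM)
  have e : F (y + dy) z1 - F y z0 - (fderiv ℝ (fun y' => F y' z0) y dy
        + fderiv ℝ (fun g' => F y g') z0 (fderiv ℝ g y dy + dg y))
      = (F (y + dy) z1 - F y z0 - (fderiv ℝ (fun y' => F y' z0) y dy
        + fderiv ℝ (fun g' => F y g') z0 (z1 - z0)))
        + fderiv ℝ (fun g' => F y g') z0 (z1 - z0 - (fderiv ℝ g y dy + dg y)) := by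
    simp only [map_sub, map_add]; abel
  rw [e]
  refine (norm_add_le _ _).trans ((add_le_add T hr2).trans (le_of_eq ?_))
  ring

lemma det_two {a b R L K h d : ℝ} (hL : 0 ≤ L) (hR : a + 2 * b + 2 ≤ R) (hlip : PLip F R L)
    (hK : ‖fderiv ℝ (fun g' => F 0 g') 0‖ ≤ K)
    {y y' dy : Fin ny → ℝ} {g g' dg : (Fin ny → ℝ) → (Fin ng → ℝ)}
    (hy : ‖y‖ ≤ a) (hg : GB b g) (hg'd : Differentiable ℝ g') (hy' : ‖y' - y‖ ≤ d)
    (hg' : GB d (g' - g)) (hd1 : d ≤ 1)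
    (hdy : ‖dy‖ ≤ h) (hdg : GB h dg) :
    ‖(fderiv ℝ (fun x => F x (g' y')) y' dy
        + fderiv ℝ (fun x => F y' x) (g' y') (fderiv ℝ g' y' dy + dg y'))
      - (fderiv ℝ (fun x => F x (g y)) y dy
        + fderiv ℝ (fun x => F y x) (g y) (fderiv ℝ g y dy + dg y))‖
    ≤ (L * (b + 2) + L * (b + 2) * (b + 2) + (K + L * (2 * R)) * (b + 2)) * d * h := by
  have hb := hg.nonneg
  have hh := hdg.nonneg
  have hd := hg'.nonneg
  have ha : 0 ≤ a := (norm_nonneg _).trans hy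
  have hgy := hg.2.1 y
  have hy'n := norm_le_norm_add_norm_sub' y' y
  have hbd : b * d ≤ b := by nlinarith
  have hz : ‖g' y' - g y‖ ≤ (b + 1) * d := by
    have e1 := hg.lip y' y
    have e2 := hg'.2.1 y'
    have e3 : b * ‖y' - y‖ ≤ b * d := by gcongr
    have e4 : g' y' - g y = (g y' - g y) + (g' - g) y' := by simp
    rw [e4]
    refine (norm_add_le _ _).trans ?_
    linarith
  have hz'n := norm_le_norm_add_norm_sub' (g' y') (g y)
  have hA : ‖fderiv ℝ g' y' - fderiv ℝ g y‖ ≤ (b + 1) * d := by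
    have e1 := hg.2.2.2 y' y
    have e2 := hg'.2.2.1 y'
    rw [fderiv_sub (hg'd y') (hg.1 y')] at e2
    have e3 : b * ‖y' - y‖ ≤ b * d := by gcongr
    have e4 : fderiv ℝ g' y' - fderiv ℝ g y = (fderiv ℝ g y' - fderiv ℝ g y)
      + (fderiv ℝ g' y' - fderiv ℝ g y') := by abel
    rw [e4]
    refine (norm_add_le _ _).trans ?_
    linarith
  have hA' : ‖fderiv ℝ g' y'‖ ≤ b + 1 := by
    have e2 := hg'.2.2.1 y'
    rw [fderiv_sub (hg'd y') (hg.1 y')] at e2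
    have := norm_le_norm_add_norm_sub' (fderiv ℝ g' y') (fderiv ℝ g y')
    have := hg.2.2.1 y'
    linarith
  have hl := hlip y' y (g' y') (g y) (by linarith) (by linarith) (by linarith) (by linarith)
  have hl2 : L * (‖y' - y‖ + ‖g' y' - g y‖) ≤ L * (b + 2) * d := by
    rw [mul_assoc]; gcongr; linarith
  have n1 := norm_nonneg (fderiv ℝ (fun x => F x (g' y')) y' - fderiv ℝ (fun x => F x (g y)) y)
  have n2 := norm_nonneg (fderiv ℝ (fun x => F y' x) (g' y') - fderiv ℝ (fun x => F y x) (g y))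
  have hM := bound_Fg hL hlip hK (y := y) (z := g y) (by linarith) (by linarith)
  have v1 : ‖fderiv ℝ g' y' dy + dg y'‖ ≤ (b + 2) * h := by
    have e1 := (fderiv ℝ g' y').le_opNorm dy
    have e2 : ‖fderiv ℝ g' y'‖ * ‖dy‖ ≤ (b + 1) * h := by gcongr
    have := hdg.2.1 y'
    refine (norm_add_le _ _).trans ?_
    linarith
  have v2 : ‖(fderiv ℝ g' y' - fderiv ℝ g y) dy + (dg y' - dg y)‖ ≤ (b + 2) * d * h := by
    have e1 := (fderiv ℝ g' y' - fderiv ℝ g y).le_opNorm dy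
    have e2 : ‖fderiv ℝ g' y' - fderiv ℝ g y‖ * ‖dy‖ ≤ (b + 1) * d * h := by gcongr
    have e3 := hdg.lip y' y
    have e4 : h * ‖y' - y‖ ≤ h * d := by gcongr
    refine (norm_add_le _ _).trans ?_
    linarith
  have w1 : ‖(fderiv ℝ (fun x => F x (g' y')) y' - fderiv ℝ (fun x => F x (g y)) y) dy‖
      ≤ (L * (b + 2) * d) * h := by
    refine (ContinuousLinearMap.le_opNorm _ _).trans ?_
    exact mul_le_mul (by linarith) hdy (norm_nonneg _) (by positivity)
  have w2 : ‖(fderiv ℝ (fun x => F y' x) (g' y') - fderiv ℝ (fun x => F y x) (g y))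
      (fderiv ℝ g' y' dy + dg y')‖ ≤ (L * (b + 2) * d) * ((b + 2) * h) := by
    refine (ContinuousLinearMap.le_opNorm _ _).trans ?_
    exact mul_le_mul (by linarith) v1 (norm_nonneg _) (by positivity)
  have w3 : ‖fderiv ℝ (fun x => F y x) (g y)
      ((fderiv ℝ g' y' - fderiv ℝ g y) dy + (dg y' - dg y))‖
      ≤ (K + L * (2 * R)) * ((b + 2) * d * h) := by
    refine (ContinuousLinearMap.le_opNorm _ _).trans ?_
    exact mul_le_mul hM v2 (norm_nonneg _) ((norm_nonneg _).trans hM)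
  have e : (fderiv ℝ (fun x => F x (g' y')) y' dy
        + fderiv ℝ (fun x => F y' x) (g' y') (fderiv ℝ g' y' dy + dg y'))
      - (fderiv ℝ (fun x => F x (g y)) y dy
        + fderiv ℝ (fun x => F y x) (g y) (fderiv ℝ g y dy + dg y))
      = (fderiv ℝ (fun x => F x (g' y')) y' - fderiv ℝ (fun x => F x (g y)) y) dy
        + (fderiv ℝ (fun x => F y' x) (g' y') - fderiv ℝ (fun x => F y x) (g y))
      (fderiv ℝ g' y' dy + dg y') + fderiv ℝ (fun x => F y x) (g y)
      ((fderiv ℝ g' y' - fderiv ℝ g y) dy + (dg y' - dg y)) := by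
    simp only [ContinuousLinearMap.sub_apply, map_add, map_sub]; abel
  rw [e]
  refine (norm_add₃_le).trans ((add_le_add (add_le_add w1 w2) w3).trans (le_of_eq ?_))
  ring

end det2

lemma delta_choice (C : ℝ) (hC : 0 ≤ C) (ε : ℝ≥0∞) (hε : 0 < ε) : ∃ δ : ℝ≥0∞, 0 < δ ∧ δ ≤ 1 ∧
    ENNReal.ofReal C * δ ≤ ε := by
  refine ⟨min 1 (ε / ENNReal.ofReal (C + 1)), ?_, min_le_left _ _, ?_⟩
  · exact lt_min one_pos (ENNReal.div_pos hε.ne' ENNReal.ofReal_ne_top)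
  · have : ENNReal.ofReal C ≤ ENNReal.ofReal (C + 1) := ENNReal.ofReal_le_ofReal (by linarith)
    exact (mul_le_mul' this (min_le_right _ _)).trans ENNReal.mul_div_le

/-- Theorem 2.9: continuous Fréchet differentiability of Nemytskii
operators `Φ : L^∞(I)^{n_y} × (G²(I))^{n_g} → L^∞(I)^{n_φ}`.  Under measurability in `t`,
continuous differentiability in `(y,g)` a.e., a uniform bound on the partial derivatives at
the origin, and a local Lipschitz condition on the partial derivatives uniform in `t`,
the operator `Φ(y,g) = φ(·, y(·), g(·, y(·)))` is Fréchet differentiable at every point of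
`L^∞(I)^{n_y} × (G²(I))^{n_g}` with derivative given by `nemDeriv` (first conjunct), and the
derivative depends continuously (in operator norm) on the point `(y,g)` (second conjunct). -/
theorem nemytskii_continuously_frechet_differentiable
    {ny ng nphi : ℕ} (t0 tf : ℝ) (ht : t0 < tf)
    (φ : ℝ → (Fin ny → ℝ) → (Fin ng → ℝ) → (Fin nphi → ℝ))
    (hφ_meas : ∀ y gv, Measurable fun t => φ t y gv)
    (hφ_diff : ∀ᵐ t ∂(μI t0 tf),
      ContDiff ℝ 1 (fun w : (Fin ny → ℝ) × (Fin ng → ℝ) => φ t w.1 w.2))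
    (hφ_bdd : ∃ K : ℝ, ∀ᵐ t ∂(μI t0 tf),
      ‖fderiv ℝ (fun y' => φ t y' 0) 0‖ ≤ K ∧ ‖fderiv ℝ (fun g' => φ t 0 g') 0‖ ≤ K)
    (hφ_lip : ∀ R : ℝ, 0 < R → ∃ L : ℝ, ∀ᵐ t ∂(μI t0 tf),
      ∀ y₁ y₂ : Fin ny → ℝ, ∀ g₁ g₂ : Fin ng → ℝ,
        ‖y₁‖ ≤ R → ‖y₂‖ ≤ R → ‖g₁‖ ≤ R → ‖g₂‖ ≤ R →
        ‖fderiv ℝ (fun y' => φ t y' g₁) y₁ - fderiv ℝ (fun y' => φ t y' g₂) y₂‖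
          + ‖fderiv ℝ (fun g' => φ t y₁ g') g₁ - fderiv ℝ (fun g' => φ t y₂ g') g₂‖
          ≤ L * (‖y₁ - y₂‖ + ‖g₁ - g₂‖)) :
    ∀ y g, MemLinf t0 tf y → MemG t0 tf 2 g →
      -- Fréchet differentiability at (y, g) with derivative `nemDeriv φ y g`:
      (∀ ε : ℝ≥0∞, 0 < ε → ∃ δ : ℝ≥0∞, 0 < δ ∧
        ∀ δy δg, MemLinf t0 tf δy → MemG t0 tf 2 δg →
          eLinf t0 tf δy + gNormE t0 tf 2 δg ≤ δ →
          eLinf t0 tf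
              (fun t => nemOp φ (y + δy) (g + δg) t - nemOp φ y g t
                - nemDeriv φ y g δy δg t)
            ≤ ε * (eLinf t0 tf δy + gNormE t0 tf 2 δg)) ∧
      -- continuity of the Fréchet derivative (y,g) ↦ Φ'(y,g) in the operator norm:
      (∀ ε : ℝ≥0∞, 0 < ε → ∃ δ : ℝ≥0∞, 0 < δ ∧
        ∀ y' g', MemLinf t0 tf y' → MemG t0 tf 2 g' →
          eLinf t0 tf (y' - y) + gNormE t0 tf 2 (g' - g) ≤ δ →
          ∀ δy δg, MemLinf t0 tf δy → MemG t0 tf 2 δg →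
            eLinf t0 tf (fun t => nemDeriv φ y' g' δy δg t - nemDeriv φ y g δy δg t)
              ≤ ε * (eLinf t0 tf δy + gNormE t0 tf 2 δg)) := by
  intro y g hy hg
  obtain ⟨K, hK⟩ := hφ_bdd
  obtain ⟨a, ha⟩ : ∃ a : ℝ, a = (eLinf t0 tf y).toReal := ⟨_, rfl⟩
  obtain ⟨b, hb⟩ : ∃ b : ℝ, b = (gNormE t0 tf 2 g).toReal := ⟨_, rfl⟩
  have ha0 : 0 ≤ a := ha ▸ ENNReal.toReal_nonneg
  have hb0 : 0 ≤ b := hb ▸ ENNReal.toReal_nonneg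
  have hya : ∀ᵐ t ∂(μI t0 tf), ‖y t‖ ≤ a :=
    ae_of_eLinf ha0 (by rw [ha, ENNReal.ofReal_toReal hy.2.ne])
  have hgb : ∀ᵐ t ∂(μI t0 tf), GB b (g t) :=
    ae_GB hb0 hg.2.1 (by rw [hb, ENNReal.ofReal_toReal hg.2.2.ne])
  obtain ⟨L, hL⟩ := hφ_lip (a + 2 * b + 2) (by positivity)
  have hlip : ∀ᵐ t ∂(μI t0 tf), PLip (φ t) (a + 2 * b + 2) |L| := by
    filter_upwards [hL] with t h y₁ y₂ g₁ g₂ h1 h2 h3 h4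
    refine (h y₁ y₂ g₁ g₂ h1 h2 h3 h4).trans ?_
    gcongr
    exact le_abs_self L
  have hK' : ∀ᵐ t ∂(μI t0 tf), ‖fderiv ℝ (fun g' => φ t 0 g') 0‖ ≤ |K| := by
    filter_upwards [hK] with t h
    exact h.2.trans (le_abs_self K)
  have hF : ∀ᵐ t ∂(μI t0 tf),
      Differentiable ℝ (fun w : (Fin ny → ℝ) × (Fin ng → ℝ) => φ t w.1 w.2) := by
    filter_upwards [hφ_diff] with t h
    exact h.differentiable (by norm_num)
  have hL0 := abs_nonneg L
  have hK0 := abs_nonneg K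
  constructor
  · intro ε hε
    obtain ⟨C, hC⟩ : ∃ C : ℝ, C = |L| * (b + 2) * (b + 2)
      + (|K| + |L| * (2 * (a + 2 * b + 2))) * (b + 1) := ⟨_, rfl⟩
    have hC0 : 0 ≤ C := by rw [hC]; positivity
    obtain ⟨δ, hδ0, hδ1, hδ⟩ := delta_choice C hC0 ε hε
    refine ⟨δ, hδ0, fun δy δg hδy hδg hle => ?_⟩
    have hfin : eLinf t0 tf δy + gNormE t0 tf 2 δg ≠ ⊤ :=
      (ENNReal.add_lt_top.2 ⟨hδy.2, hδg.2.2⟩).ne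
    obtain ⟨h, hh⟩ : ∃ h : ℝ, h = (eLinf t0 tf δy + gNormE t0 tf 2 δg).toReal := ⟨_, rfl⟩
    have hh' : eLinf t0 tf δy + gNormE t0 tf 2 δg = ENNReal.ofReal h := by
      rw [hh, ENNReal.ofReal_toReal hfin]
    have hh0 : 0 ≤ h := hh ▸ ENNReal.toReal_nonneg
    have hh1 : h ≤ 1 := by
      have := hle.trans hδ1
      rw [hh'] at this
      simpa using this
    have d1 := ae_of_eLinf hh0 (le_self_add.trans hh'.le)
    have d2 := ae_GB hh0 hδg.2.1 (le_add_self.trans hh'.le)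
    refine (eLinf_le (B := C * h * h) ?_).trans ?_
    · filter_upwards [hya, hgb, hlip, hK', hF, d1, d2] with t q1 q2 q3 q4 q5 q6 q7
      rw [hC]
      exact det_one q5 hL0 le_rfl q3 q4 q1 q2 q6 q7 hh1
    · rw [ENNReal.ofReal_mul (by positivity), ENNReal.ofReal_mul hC0, ← hh']
      gcongr
      exact (mul_le_mul_right hle _).trans hδ
  · intro ε hε
    obtain ⟨C, hC⟩ : ∃ C : ℝ, C = |L| * (b + 2) + |L| * (b + 2) * (b + 2)
      + (|K| + |L| * (2 * (a + 2 * b + 2))) * (b + 2) := ⟨_, rfl⟩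
    have hC0 : 0 ≤ C := by rw [hC]; positivity
    obtain ⟨δ, hδ0, hδ1, hδ⟩ := delta_choice C hC0 ε hε
    refine ⟨δ, hδ0, fun y' g' hy' hg' hle δy δg hδy hδg => ?_⟩
    have hfin : eLinf t0 tf δy + gNormE t0 tf 2 δg ≠ ⊤ :=
      (ENNReal.add_lt_top.2 ⟨hδy.2, hδg.2.2⟩).ne
    obtain ⟨h, hh⟩ : ∃ h : ℝ, h = (eLinf t0 tf δy + gNormE t0 tf 2 δg).toReal := ⟨_, rfl⟩
    have hh' : eLinf t0 tf δy + gNormE t0 tf 2 δg = ENNReal.ofReal h := by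
      rw [hh, ENNReal.ofReal_toReal hfin]
    have hh0 : 0 ≤ h := hh ▸ ENNReal.toReal_nonneg
    have hfin2 : eLinf t0 tf (y' - y) + gNormE t0 tf 2 (g' - g) ≠ ⊤ :=
      ((hle.trans hδ1).trans_lt ENNReal.one_lt_top).ne
    obtain ⟨d, hd⟩ : ∃ d : ℝ, d = (eLinf t0 tf (y' - y) + gNormE t0 tf 2 (g' - g)).toReal :=
      ⟨_, rfl⟩
    have hd' : eLinf t0 tf (y' - y) + gNormE t0 tf 2 (g' - g) = ENNReal.ofReal d := by
      rw [hd, ENNReal.ofReal_toReal hfin2]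
    have hd0 : 0 ≤ d := hd ▸ ENNReal.toReal_nonneg
    have hd1 : d ≤ 1 := by
      have := hle.trans hδ1
      rw [hd'] at this
      simpa using this
    have d1 := ae_of_eLinf hh0 (le_self_add.trans hh'.le)
    have d2 := ae_GB hh0 hδg.2.1 (le_add_self.trans hh'.le)
    have d3 := ae_of_eLinf hd0 (le_self_add.trans hd'.le)
    have hcd : ∀ᵐ t ∂(μI t0 tf), ContDiff ℝ ((2 : ℕ) : ℕ∞) ((g' - g) t) := by
      filter_upwards [hg.2.1, hg'.2.1] with t p1 p2
      exact p2.sub p1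
    have d4 := ae_GB hd0 hcd (le_add_self.trans hd'.le)
    refine (eLinf_le (B := C * d * h) ?_).trans ?_
    · filter_upwards [hya, hgb, hlip, hK', d1, d2, d3, d4, hg'.2.1] with t q1 q2 q3 q4 q6 q7 q8 q9 q10
      rw [hC]
      have q11 : ContDiff ℝ 2 (g' t) := q10
      exact det_two hL0 le_rfl q3 q4 q1 q2 (q11.differentiable (by norm_num)) q8 q9 hd1 q6 q7
    · rw [ENNReal.ofReal_mul (by positivity), ENNReal.ofReal_mul hC0, ← hh', ← hd']
      gcongr
      exact (mul_le_mul_right hle _).trans hδ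

end
end
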